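/- arXiv:math/0201035 — 6 statements merged into one kernel-verified Lean document; each statement's English description precedes it below -/
import Mathlib

section
/- Let f₂, f₃ ∈ ℂ[x,y] with total degrees 2 and 3 respectively, and set f = f₂³ + f₃². Assume f is irreducible as a polynomial and has total degree 6. If P ∈ ℂ² satisfies f(P) = 0, ∂f/∂x(P) = 0 and ∂f/∂y(P) = 0 (i.e. P is a singular point of the sextic f = 0), and f₂(P) ≠ 0 (P is an outer singularity), then the multiplicity of f at P is at most 3; that is, there exist nonnegative integers i, j with i + j ≤ 3 such that the iterated partial derivative ∂^{i+j} f / ∂x^i ∂y^j does not vanish at P. -/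
namespace MvPolynomial

section CommRing

variable {σ R : Type*} [CommRing R]

theorem pderiv_pderiv_comm (i j : σ) (p : MvPolynomial σ R) :
    pderiv i (pderiv j p) = pderiv j (pderiv i p) := by
  classical
  ext m
  simp only [coeff_pderiv]
  rcases eq_or_ne i j with rfl | h
  · rfl
  · simp [h, h.symm, add_right_comm m]
    ring

theorem totalDegree_pderiv_le {p : MvPolynomial σ R} {n : ℕ} (hp : p.totalDegree ≤ n + 1)
    (i : σ) : (pderiv i p).totalDegree ≤ n := by
  classical
  refine Finset.sup_le fun m hm ↦ ?_
  have hm' : m + Finsupp.single i 1 ∈ p.support := by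
    rw [mem_support_iff, coeff_pderiv] at hm
    exact mem_support_iff.2 (left_ne_zero_of_mul hm)
  have h := (le_totalDegree hm').trans hp
  rw [Finsupp.sum_add_index' (by simp) (by simp), Finsupp.sum_single_index rfl] at h
  exact Nat.le_of_succ_le_succ h

theorem totalDegree_eq_zero_of_pderiv_eq_zero [IsDomain R] [CharZero R] {p : MvPolynomial σ R}
    (hp : ∀ i, pderiv i p = 0) : p.totalDegree = 0 := by
  classical
  refine totalDegree_eq_zero_iff_eq_C.2 (ext _ _ fun m ↦ ?_)
  rcases eq_or_ne m 0 with rfl | hm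
  · simp
  obtain ⟨i, hi⟩ := Finsupp.ne_iff.1 hm
  rw [coeff_C, if_neg hm.symm]
  have h := congrArg (coeff (m - Finsupp.single i 1)) (hp i)
  rw [coeff_pderiv, Finsupp.sub_add_single_one_cancel hi, coeff_zero] at h
  exact (mul_eq_zero.1 h).resolve_right (Nat.cast_add_one_ne_zero _)

/-- The polynomial `p` vanishes to order at least `n` at `P`: all of its iterated partial
derivatives of order less than `n` are zero at `P`. -/
def VanishesToOrder (P : σ → R) : ℕ → MvPolynomial σ R → Prop
  | 0, _ => True
  | n + 1, p => eval P p = 0 ∧ ∀ i, VanishesToOrder P n (pderiv i p)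

namespace VanishesToOrder

variable {P : σ → R}

theorem of_succ {n : ℕ} {p : MvPolynomial σ R} (hp : VanishesToOrder P (n + 1) p) :
    VanishesToOrder P n p := by
  induction n generalizing p with
  | zero => trivial
  | succ n ih => exact ⟨hp.1, fun i ↦ ih (hp.2 i)⟩

theorem add {n : ℕ} {p q : MvPolynomial σ R} (hp : VanishesToOrder P n p)
    (hq : VanishesToOrder P n q) : VanishesToOrder P n (p + q) := by
  induction n generalizing p q with
  | zero => trivial
  | succ n ih =>
    refine ⟨by simp [hp.1, hq.1], fun i ↦ ?_⟩
    rw [map_add]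
    exact ih (hp.2 i) (hq.2 i)

theorem neg {n : ℕ} {p : MvPolynomial σ R} (hp : VanishesToOrder P n p) :
    VanishesToOrder P n (-p) := by
  induction n generalizing p with
  | zero => trivial
  | succ n ih =>
    refine ⟨by simp [hp.1], fun i ↦ ?_⟩
    rw [map_neg]
    exact ih (hp.2 i)

theorem mul {m n : ℕ} {p q : MvPolynomial σ R} (hp : VanishesToOrder P m p)
    (hq : VanishesToOrder P n q) : VanishesToOrder P (m + n) (p * q) := by
  induction h : m + n generalizing m n p q with
  | zero => trivial
  | succ k ih =>
    refine ⟨?_, fun i ↦ ?_⟩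
    · rcases m with _ | m
      · rcases n with _ | n
        · omega
        · simp [hq.1]
      · simp [hp.1]
    · rw [pderiv_mul]
      refine add ?_ ?_
      · rcases m with _ | m
        · obtain rfl : n = k + 1 := by omega
          exact ih (m := 0) trivial hq.of_succ (by omega)
        · exact ih (hp.2 i) hq (by omega)
      · rcases n with _ | n
        · obtain rfl : m = k + 1 := by omega
          exact ih hp.of_succ (n := 0) trivial (by omega)
        · exact ih hp (hq.2 i) (by omega)

theorem of_mul_left [IsDomain R] {n : ℕ} {p q : MvPolynomial σ R}
    (hpq : VanishesToOrder P n (p * q)) (hq : eval P q ≠ 0) : VanishesToOrder P n p := by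
  induction n generalizing p with
  | zero => trivial
  | succ n ih =>
    have hp : VanishesToOrder P n p := ih hpq.of_succ
    refine ⟨by simpa [hq] using hpq.1, fun i ↦ ih ?_⟩
    have h := hpq.2 i
    rw [pderiv_mul] at h
    simpa using h.add (hp.mul (n := 0) (q := pderiv i q) trivial).neg

theorem eq_zero_of_totalDegree_lt [IsDomain R] [CharZero R] {n : ℕ} {p : MvPolynomial σ R}
    (hp : VanishesToOrder P n p) (hn : p.totalDegree < n) : p = 0 := by
  induction n generalizing p with
  | zero => omega
  | succ n ih =>
    have hconst : p.totalDegree = 0 := by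
      rcases n with _ | n
      · omega
      exact totalDegree_eq_zero_of_pderiv_eq_zero fun i ↦
        ih (hp.2 i) (Nat.lt_succ_of_le (totalDegree_pderiv_le (Nat.lt_succ_iff.1 hn) i))
    have h := hp.1
    rw [totalDegree_eq_zero_iff_eq_C.1 hconst] at h ⊢
    simpa using h

theorem of_iterate_pderiv {P : Fin 2 → R} {n : ℕ} {p : MvPolynomial (Fin 2) R}
    (hp : ∀ i j, i + j < n → eval P ((pderiv 0)^[i] ((pderiv 1)^[j] p)) = 0) :
    VanishesToOrder P n p := by
  induction n generalizing p with
  | zero => trivial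
  | succ n ih =>
    refine ⟨hp 0 0 (by omega), Fin.forall_fin_two.2 ⟨ih fun i j hij ↦ ?_, ih fun i j hij ↦ ?_⟩⟩
    · have hc : Function.Commute (pderiv 1) (pderiv (R := R) (0 : Fin 2)) :=
        pderiv_pderiv_comm 1 0
      rw [(hc.iterate_left j).eq p, ← Function.iterate_succ_apply]
      exact hp (i + 1) j (by omega)
    · rw [← Function.iterate_succ_apply]
      exact hp i (j + 1) (by omega)

end VanishesToOrder

end CommRing

/-- A polynomial with nonzero square value at `P` agrees to first order at `P` with the square of a
polynomial of degree at most one. -/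
theorem exists_vanishesToOrder_two_sub_sq {σ K : Type*} [Fintype σ] [Field K] [NeZero (2 : K)]
    {P : σ → K} {g : MvPolynomial σ K} {α : K} (hα : α ≠ 0) (hg : eval P g = α ^ 2) :
    ∃ s : MvPolynomial σ K, s.totalDegree ≤ 1 ∧ eval P s = α ∧
      VanishesToOrder P 2 (g - s ^ 2) := by
  classical
  have h2 : (2 : K) ≠ 0 := NeZero.ne 2
  refine ⟨C α + ∑ i, C (eval P (pderiv i g) / (2 * α)) * (X i - C (P i)), ?_, by simp, ?_⟩
  · refine (totalDegree_add _ _).trans (max_le (by simp) (totalDegree_finsetSum_le fun i _ ↦ ?_))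
    refine (totalDegree_mul _ _).trans ?_
    rw [totalDegree_C, zero_add]
    exact (totalDegree_sub_C_le _ _).trans (totalDegree_X _).le
  · refine ⟨by simp [hg], fun i ↦ ⟨?_, fun _ ↦ trivial⟩⟩
    simp [Pi.single_apply]
    field_simp
    ring

end MvPolynomial

open MvPolynomial

/-- Let `f₂, f₃ ∈ ℂ[x,y]` of total degrees 2 and 3, and set
`f = f₂³ + f₃²`. If `f` is irreducible of total degree 6, and `P` is a singular point
of the sextic `f = 0` with `f₂(P) ≠ 0` (an outer singularity), then the multiplicity
of `f` at `P` is at most 3: some iterated partial derivative of order `≤ 3` of `f`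
does not vanish at `P`. -/
theorem outer_singularity_multiplicity_le_three
    (f₂ f₃ : MvPolynomial (Fin 2) ℂ)
    (hdeg2 : f₂.totalDegree = 2) (hdeg3 : f₃.totalDegree = 3)
    (f : MvPolynomial (Fin 2) ℂ) (hf : f = f₂ ^ 3 + f₃ ^ 2)
    (hirr : Irreducible f) (hdeg6 : f.totalDegree = 6)
    (P : Fin 2 → ℂ)
    (hP0 : eval P f = 0)
    (hPx : eval P (pderiv (0 : Fin 2) f) = 0)
    (hPy : eval P (pderiv (1 : Fin 2) f) = 0)
    (houter : eval P f₂ ≠ 0) :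
    ∃ i j : ℕ, i + j ≤ 3 ∧
      eval P ((pderiv (0 : Fin 2))^[i] ((pderiv (1 : Fin 2))^[j] f)) ≠ 0 := by
  by_contra! hvan
  have hf4 : VanishesToOrder P 4 f :=
    .of_iterate_pderiv fun i j hij ↦ hvan i j (Nat.lt_succ_iff.1 hij)
  have hsq : eval P f₃ ^ 2 = -eval P f₂ ^ 3 := by
    rw [hf] at hP0
    simp only [map_add, map_pow] at hP0
    linear_combination hP0
  have h3 : eval P f₃ ≠ 0 := by
    intro h
    simp [h, houter] at hsq
  -- `-f₂ = s² + r` and `f₃ = s³ + (3/2) s r + d`, with `r` of order two at `P`.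
  obtain ⟨s, hs1, hsP, hr⟩ := exists_vanishesToOrder_two_sub_sq (P := P) (g := -f₂)
    (α := -eval P f₃ / eval P f₂) (by simp [h3, houter]) (by
      rw [map_neg]
      field_simp
      linear_combination -hsq)
  obtain ⟨r, hr_def⟩ : ∃ r, r = -f₂ - s ^ 2 := ⟨_, rfl⟩
  rw [← hr_def] at hr
  obtain ⟨c, hc_deg, hc⟩ : ∃ c : MvPolynomial (Fin 2) ℂ, c.totalDegree = 0 ∧ 2 * c = 1 := by
    refine ⟨C (1 / 2), totalDegree_C _, ?_⟩
    rw [← map_ofNat (C (R := ℂ) (σ := Fin 2)) 2, ← C_mul]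
    norm_num
  obtain ⟨d, hd_def⟩ : ∃ d, d = f₃ - s ^ 3 - 3 * c * s * r := ⟨_, rfl⟩
  have hr_deg : r.totalDegree ≤ 2 := by
    rw [hr_def]
    refine (totalDegree_sub _ _).trans (max_le (by rw [totalDegree_neg, hdeg2]) ?_)
    exact (totalDegree_pow _ _).trans (by omega)
  have hd_deg : d.totalDegree ≤ 3 := by
    rw [hd_def]
    refine (totalDegree_sub _ _).trans (
      max_le ((totalDegree_sub _ _).trans (max_le hdeg3.le ?_)) ?_)
    · exact (totalDegree_pow _ _).trans (by omega)
    · have h1 := totalDegree_mul (3 * c * s) r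
      have h2 := totalDegree_mul (3 * c) s
      have h3 := totalDegree_mul 3 c
      have h4 : (3 : MvPolynomial (Fin 2) ℂ).totalDegree = 0 := by
        rw [← map_ofNat (C (R := ℂ) (σ := Fin 2)) 3, totalDegree_C]
      omega
  have hf_eq :
      f = d * (f₃ + s ^ 3 + 3 * c * s * r) - r * r * (r + 3 * s ^ 2 - 9 * c ^ 2 * s ^ 2) := by
    rw [hf, show f₂ = -(r + s ^ 2) by rw [hr_def]; ring, hd_def]
    linear_combination (3 * s ^ 4 * r) * hc
  have hd : d = 0 := by
    have hdu : VanishesToOrder P 4 (d * (f₃ + s ^ 3 + 3 * c * s * r)) := by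
      have h := hf4.add
        ((hr.mul hr).mul (n := 0) (q := r + 3 * s ^ 2 - 9 * c ^ 2 * s ^ 2) trivial)
      rwa [hf_eq, sub_add_cancel] at h
    refine (hdu.of_mul_left ?_).eq_zero_of_totalDegree_lt (by omega)
    have : eval P (f₃ + s ^ 3 + 3 * c * s * r) = 2 * eval P f₃ := by
      simp only [map_add, map_mul, map_pow, hr.1, hsP]
      field_simp
      linear_combination -hsq
    rw [this]
    exact mul_ne_zero two_ne_zero h3
  have hr_unit : ¬ IsUnit r := fun h ↦ not_isUnit_zero (hr.1 ▸ h.map (eval P))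
  have hf_fac : f = r * (r * -(r + 3 * s ^ 2 - 9 * c ^ 2 * s ^ 2)) := by
    rw [hf_eq, hd]
    ring
  rcases hirr.isUnit_or_isUnit hf_fac with h | h
  · exact hr_unit h
  · exact hr_unit (isUnit_of_mul_isUnit_left h)
end

section
/- The following identity holds in ℂ[x,y]: (y² + 1/2 − (1/2)x² + (1/2)I√3·x² − (1/2)I√3)³ + ((18 − 6I√3)/16)·(1 − x + I√3·y² − x² + x³ + x·y²)² = (y² − 1 + x²)³ + ((18 − 6I√3)/16)·(x³ − x² − I√3·x·y² − x + 1 − y²)². Moreover, there is no t ∈ ℂ with y² − 1 + x² = t²·(y² + 1/2 − (1/2)x² + (1/2)I√3·x² − (1/2)I√3); hence the sextic on the left admits two torus decompositions that are not equivalent under the weighted ℂ*-action (f₂, f₃) ↦ (t²f₂, t³f₃). -/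
open MvPolynomial

/-- `x` in `ℂ[x,y]`. -/
noncomputable def px : MvPolynomial (Fin 2) ℂ := X 0
/-- `y` in `ℂ[x,y]`. -/
noncomputable def py : MvPolynomial (Fin 2) ℂ := X 1

/-- `I√3 ∈ ℂ`. -/
noncomputable def is3 : ℂ := Complex.I * (Real.sqrt 3 : ℂ)

/-- The conic `f₂ₐ` of configuration nt67. -/
noncomputable def f2a : MvPolynomial (Fin 2) ℂ :=
  py ^ 2 + C ((1 : ℂ) / 2) - C ((1 : ℂ) / 2) * px ^ 2
    + C (is3 / 2) * px ^ 2 - C (is3 / 2)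

theorem is3_sq : is3 ^ 2 = -3 := by
  have h : ((Real.sqrt 3 : ℝ) : ℂ) ^ 2 = 3 := by
    rw [← Complex.ofReal_pow, Real.sq_sqrt (by norm_num)]
    norm_num
  rw [is3, mul_pow, Complex.I_sq, h]
  norm_num

theorem eval_f2a (p : Fin 2 → ℂ) :
    eval p f2a = p 1 ^ 2 + 1 / 2 - 1 / 2 * p 0 ^ 2 + is3 / 2 * p 0 ^ 2 - is3 / 2 := by
  simp [f2a, px, py]

/-- The sextic `f_a = f₂ₐ³ + f₃ₐ²` of configuration
`nt67 = [[2A₂,A₅,E₆],[2A₂]]` satisfies the identity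
`f₂ₐ³ + ((18−6I√3)/16)(1 − x + I√3y² − x² + x³ + xy²)²
  = (y² − 1 + x²)³ + ((18−6I√3)/16)(x³ − x² − I√3xy² − x + 1 − y²)²`,
and there is no `t ∈ ℂ` with `y² − 1 + x² = t²·f₂ₐ`: the sextic admits two torus
decompositions which are not equivalent under the weighted `ℂ*`-action. -/
theorem nt67_two_torus_decompositions :
    (f2a ^ 3
        + C ((18 - 6 * is3) / 16)
          * (1 - px + C is3 * py ^ 2 - px ^ 2 + px ^ 3 + px * py ^ 2) ^ 2
      = (py ^ 2 - 1 + px ^ 2) ^ 3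
        + C ((18 - 6 * is3) / 16)
          * (px ^ 3 - px ^ 2 - C is3 * (px * py ^ 2) - px + 1 - py ^ 2) ^ 2)
    ∧ ¬ ∃ t : ℂ, (py ^ 2 - 1 + px ^ 2) = C (t ^ 2) * f2a := by
  constructor
  · refine MvPolynomial.funext fun p => ?_
    simp only [map_add, map_sub, map_mul, map_pow, map_one, eval_f2a, px, py, eval_X, eval_C]
    linear_combination
      (3 - is3) / 8 * (1 + 3 * p 1 ^ 4 * (1 - p 0 ^ 2) - 3 * p 0 ^ 2 + 3 * p 0 ^ 4 - p 0 ^ 6) * is3_sq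
  · rintro ⟨t, ht⟩
    have h_one := congrArg (eval ![1, 1]) ht
    have h_zero := congrArg (eval ![0, 0]) ht
    simp only [map_add, map_sub, map_mul, map_pow, map_one, eval_f2a, px, py, eval_X, eval_C,
      Matrix.cons_val_zero, Matrix.cons_val_one] at h_one h_zero
    have h_t : t ^ 2 = 1 := by linear_combination -h_one
    rw [h_t] at h_zero
    have h_three : is3 = 3 := by linear_combination 2 * h_zero
    have h_sq := is3_sq
    rw [h_three] at h_sq
    norm_num at h_sq
end

section
/- For every t₁ ∈ ℂ with t₁ ≠ 0, setting t₀ = 2I√3/t₁, the following identity holds in ℂ[x,y]: (y² + (−3 − t₁²)x² + 2x)³ + ( −(1/(2t₁))·(−6xy² − 3t₁²·xy² + 6y² + 6x³ + 9t₁²·x³ + 2t₁⁴·x³ − 6t₁²·x² − 6x²) )² = (y² + (3 − t₀²)x² + (−4 + 2t₀²)x − t₀²)³ + ( (1/(2t₀))·(6xy² − 3t₀²·xy² + 3t₀²·y² + 6x³ − 9t₀²·x³ + 2t₀⁴·x³ − 12x² + 21t₀²·x² − 6t₀⁴·x² − 12t₀²·x + 6t₀⁴·x − 2t₀⁴) )².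 -/
open MvPolynomial

/-- For every `t₁ ≠ 0`, with `t₀ = 2I√3/t₁`, the one-parameter normal
form of the distinguished configuration `[[4A₂,E₆],[2A₂]]` (nt52, left-hand side) and
the normal form of `[[6A₂],[E₆]]` (nt8, right-hand side) define the same sextic of
torus type; this is part (2) of the paper's Theorem 20. -/
theorem nt52_eq_nt8 (t₁ t₀ : ℂ) (ht₁ : t₁ ≠ 0)
    (ht₀ : t₀ = 2 * Complex.I * (Real.sqrt 3 : ℂ) / t₁) :
    ((X 1 : MvPolynomial (Fin 2) ℂ) ^ 2 + C (-3 - t₁ ^ 2) * X 0 ^ 2 + 2 * X 0) ^ 3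
      + (C (-(1 / (2 * t₁))) *
          (-6 * (X 0 * X 1 ^ 2) - C (3 * t₁ ^ 2) * (X 0 * X 1 ^ 2) + 6 * X 1 ^ 2
            + 6 * X 0 ^ 3 + C (9 * t₁ ^ 2) * X 0 ^ 3 + C (2 * t₁ ^ 4) * X 0 ^ 3
            - C (6 * t₁ ^ 2) * X 0 ^ 2 - 6 * X 0 ^ 2)) ^ 2
    = ((X 1 : MvPolynomial (Fin 2) ℂ) ^ 2 + C (3 - t₀ ^ 2) * X 0 ^ 2
          + C (-4 + 2 * t₀ ^ 2) * X 0 - C (t₀ ^ 2)) ^ 3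
      + (C (1 / (2 * t₀)) *
          (6 * (X 0 * X 1 ^ 2) - C (3 * t₀ ^ 2) * (X 0 * X 1 ^ 2)
            + C (3 * t₀ ^ 2) * X 1 ^ 2 + 6 * X 0 ^ 3 - C (9 * t₀ ^ 2) * X 0 ^ 3
            + C (2 * t₀ ^ 4) * X 0 ^ 3 - 12 * X 0 ^ 2 + C (21 * t₀ ^ 2) * X 0 ^ 2
            - C (6 * t₀ ^ 4) * X 0 ^ 2 - C (12 * t₀ ^ 2) * X 0
            + C (6 * t₀ ^ 4) * X 0 - C (2 * t₀ ^ 4))) ^ 2 := by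
  have h_sq : t₀ ^ 2 = -12 / t₁ ^ 2 := by
    have h_three : (Real.sqrt 3 : ℂ) ^ 2 = 3 := by
      exact_mod_cast Real.sq_sqrt (show (0 : ℝ) ≤ 3 by norm_num)
    rw [ht₀, div_pow, mul_pow, mul_pow, Complex.I_sq, h_three]
    norm_num
  have h_four : t₀ ^ 4 = (-12 / t₁ ^ 2) ^ 2 := by
    rw [← h_sq, ← pow_mul]
  apply MvPolynomial.funext
  intro v
  simp only [map_add, map_sub, map_mul, map_pow, map_neg, map_ofNat, eval_X, eval_C]
  simp only [mul_pow, div_pow, neg_sq, h_sq, h_four, one_pow]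
  field_simp
  ring
end

section
/- For all a, t ∈ ℂ with t ≠ 0, the following identity holds in ℂ[x,y]: ( y² + (−1 − a + t²)x² + a·x − t² )³ + ( −(1/(2t))·(−3t²·xy² + 3a·xy² + 6xy² − 3t²·y² + 4t⁴·x³ − 9t²·x³ − 3a·t²·x³ + 3a·x³ + 6x³ − 6t⁴·x² + 15t²·x² + 6a·t²·x² − 6a·x² − 12x² − 3a·t²·x + 2t⁴) )² = ( (1/t²)·(4t⁴·x + 8t⁴·x² − 19t²·x² − 2a·t²·x + t²·y² − 10a·t²·x² − 6t²·x + 12a·x² + 12x² + 3a²·x²) )³ + ( −(I√3/(2t³))·(t⁴·y² − 4t⁴·x + 2t⁶·x − 6t²·xy² + 5t⁴·xy² + 36t²·x² − 53t⁴·x² + 20t⁶·x² − 48x³ + 114t²·x³ − 93t⁴·x³ + 26t⁶·x³ − a·t⁴·x − 3a·t²·xy² + 30a·t²·x² − 22a·t⁴·x² − 72a·x³ + 117a·t²·x³ − 49a·t⁴·x³ + 6a²·t²·x² − 36a²·x³ + 30a²·t²·x³ − 6a³·x³) )². -/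
open MvPolynomial

/-- Clearing denominators in an equality of torus decompositions
`p³ + (-q/(2t))² = (h/t²)³ + (-(i√3)k/(2t³))²` leaves an identity without division. -/
theorem torus_decomposition_eq_of_cleared {t p q h k : ℂ} (ht : t ≠ 0)
    (H : 4 * t ^ 6 * p ^ 3 + t ^ 4 * q ^ 2 = 4 * h ^ 3 - 3 * k ^ 2) :
    p ^ 3 + (-(1 / (2 * t)) * q) ^ 2
      = (1 / t ^ 2 * h) ^ 3 + (-(Complex.I * (Real.sqrt 3 : ℂ) / (2 * t ^ 3)) * k) ^ 2 := by
  have hs : (Complex.I * (Real.sqrt 3 : ℂ)) ^ 2 = -3 := by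
    rw [mul_pow, Complex.I_sq, ← Complex.ofReal_pow, Real.sq_sqrt (by norm_num)]
    norm_num
  have hk : (-(Complex.I * (Real.sqrt 3 : ℂ) / (2 * t ^ 3)) * k) ^ 2
      = -3 * k ^ 2 / (4 * t ^ 6) := by
    rw [mul_pow, neg_sq, div_pow, hs]
    ring
  rw [hk]
  field_simp
  linear_combination 4 * H

set_option maxHeartbeats 1600000 in
/-- For all `a, t ∈ ℂ` with `t ≠ 0`, the two-parameter normal form of
the moduli slice of the distinguished configuration `[[6A₂],[A₅]]` (nt5, left-hand side)
coincides with the sextic of the second torus decomposition `(h₂, h₃)` constructed in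
Proposition 21 (right-hand side), which realizes it in the distinguished configuration
`[[4A₂,A₅],[2A₂]]` (nt37). -/
theorem nt5_eq_nt37 (a t : ℂ) (ht : t ≠ 0) :
    ((X 1 : MvPolynomial (Fin 2) ℂ) ^ 2 + C (-1 - a + t ^ 2) * X 0 ^ 2
        + C a * X 0 - C (t ^ 2)) ^ 3
      + (C (-(1 / (2 * t))) *
          (-(C (3 * t ^ 2)) * (X 0 * X 1 ^ 2) + C (3 * a) * (X 0 * X 1 ^ 2)
            + 6 * (X 0 * X 1 ^ 2) - C (3 * t ^ 2) * X 1 ^ 2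
            + C (4 * t ^ 4) * X 0 ^ 3 - C (9 * t ^ 2) * X 0 ^ 3
            - C (3 * a * t ^ 2) * X 0 ^ 3 + C (3 * a) * X 0 ^ 3 + 6 * X 0 ^ 3
            - C (6 * t ^ 4) * X 0 ^ 2 + C (15 * t ^ 2) * X 0 ^ 2
            + C (6 * a * t ^ 2) * X 0 ^ 2 - C (6 * a) * X 0 ^ 2 - 12 * X 0 ^ 2
            - C (3 * a * t ^ 2) * X 0 + C (2 * t ^ 4))) ^ 2
    = (C (1 / t ^ 2) *
          (C (4 * t ^ 4) * X 0 + C (8 * t ^ 4) * X 0 ^ 2 - C (19 * t ^ 2) * X 0 ^ 2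
            - C (2 * a * t ^ 2) * X 0 + C (t ^ 2) * X 1 ^ 2
            - C (10 * a * t ^ 2) * X 0 ^ 2 - C (6 * t ^ 2) * X 0
            + C (12 * a) * X 0 ^ 2 + 12 * X 0 ^ 2 + C (3 * a ^ 2) * X 0 ^ 2)) ^ 3
      + (C (-(Complex.I * (Real.sqrt 3 : ℂ) / (2 * t ^ 3))) *
          (C (t ^ 4) * X 1 ^ 2 - C (4 * t ^ 4) * X 0 + C (2 * t ^ 6) * X 0
            - C (6 * t ^ 2) * (X 0 * X 1 ^ 2) + C (5 * t ^ 4) * (X 0 * X 1 ^ 2)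
            + C (36 * t ^ 2) * X 0 ^ 2 - C (53 * t ^ 4) * X 0 ^ 2
            + C (20 * t ^ 6) * X 0 ^ 2 - 48 * X 0 ^ 3 + C (114 * t ^ 2) * X 0 ^ 3
            - C (93 * t ^ 4) * X 0 ^ 3 + C (26 * t ^ 6) * X 0 ^ 3
            - C (a * t ^ 4) * X 0 - C (3 * a * t ^ 2) * (X 0 * X 1 ^ 2)
            + C (30 * a * t ^ 2) * X 0 ^ 2 - C (22 * a * t ^ 4) * X 0 ^ 2
            - C (72 * a) * X 0 ^ 3 + C (117 * a * t ^ 2) * X 0 ^ 3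
            - C (49 * a * t ^ 4) * X 0 ^ 3 + C (6 * a ^ 2 * t ^ 2) * X 0 ^ 2
            - C (36 * a ^ 2) * X 0 ^ 3 + C (30 * a ^ 2 * t ^ 2) * X 0 ^ 3
            - C (6 * a ^ 3) * X 0 ^ 3)) ^ 2 := by
  refine MvPolynomial.funext fun v => ?_
  simp only [map_add, map_sub, map_mul, map_pow, map_neg, map_ofNat, eval_C, eval_X]
  refine torus_decomposition_eq_of_cleared ht ?_
  ring
end

section
/- Let a, t ∈ ℂ with t ≠ 0 and a − 2t² + 2 ≠ 0. Set a₂₀ = (3a² − 10a·t² + 12a − 19t² + 8t⁴ + 12)/t² and t₁ = I√3·(a − 2t² + 2)/t (so t₁ ≠ 0). Then −(1/2)·(3a₂₀² + 5a₂₀·t₁² − 6a₂₀ − t₁² + 3 + 2t₁⁴)/t₁² = a and −(1/2)·I√3·(−1 + t₁² + a₂₀)/t₁ = −t. (In other words, the composition ξ₂ ∘ ξ₁ of the paper's parameter correspondences acts on the parameters by (a₁₀, t₀) ↦ (a₁₀, −t₀).) -/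
/-- The composition `ξ₂ ∘ ξ₁` of the parameter correspondences of
Proposition 21 (between the moduli slices of `[[6A₂],[A₅]]` and `[[4A₂,A₅],[2A₂]]`)
acts on the slice parameters by `(a₁₀, t₀) ↦ (a₁₀, −t₀)`. -/
theorem xi2_comp_xi1 (a t : ℂ) (ht : t ≠ 0) (h : a - 2 * t ^ 2 + 2 ≠ 0)
    (a20 t1 : ℂ)
    (ha20 : a20 = (3 * a ^ 2 - 10 * a * t ^ 2 + 12 * a - 19 * t ^ 2 + 8 * t ^ 4 + 12) / t ^ 2)
    (ht1 : t1 = Complex.I * (Real.sqrt 3 : ℂ) * (a - 2 * t ^ 2 + 2) / t) :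
    t1 ≠ 0 ∧
    -(1 / 2) * (3 * a20 ^ 2 + 5 * a20 * t1 ^ 2 - 6 * a20 - t1 ^ 2 + 3 + 2 * t1 ^ 4) / t1 ^ 2
      = a ∧
    -(1 / 2) * Complex.I * (Real.sqrt 3 : ℂ) * (-1 + t1 ^ 2 + a20) / t1 = -t := by
  have hr : (Real.sqrt 3 : ℂ) ^ 2 = 3 := by
    norm_cast
    norm_num
  have hr0 : (Real.sqrt 3 : ℂ) ≠ 0 := by
    intro h0
    norm_num [h0] at hr
  have ht1_ne : t1 ≠ 0 := by
    rw [ht1]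
    exact div_ne_zero (mul_ne_zero (mul_ne_zero Complex.I_ne_zero hr0) h) ht
  have hmul : t1 * t = Complex.I * (Real.sqrt 3 : ℂ) * (a - 2 * t ^ 2 + 2) := by
    rw [ht1, div_mul_cancel₀ _ ht]
  have hsq : t1 ^ 2 * t ^ 2 = -3 * (a - 2 * t ^ 2 + 2) ^ 2 := by
    rw [← mul_pow, hmul, mul_pow, mul_pow, Complex.I_sq, hr]
    ring
  have hb : a20 = 2 * a + 5 - 4 * t ^ 2 - t1 ^ 2 := by
    rw [ha20, div_eq_iff (pow_ne_zero 2 ht)]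
    linear_combination hsq
  refine ⟨ht1_ne, ?_, ?_⟩
  · rw [div_eq_iff (pow_ne_zero 2 ht1_ne), hb]
    linear_combination -2 * hsq
  · rw [div_eq_iff ht1_ne, hb]
    linear_combination hmul
end

section
/- Let b, u ∈ ℂ with u ≠ 0 and −1 + u² + b ≠ 0. Set a = −(1/2)·(3b² + 5b·u² − 6b − u² + 3 + 2u⁴)/u² and t = −(1/2)·I√3·(−1 + u² + b)/u (so t ≠ 0). Then (3a² − 10a·t² + 12a − 19t² + 8t⁴ + 12)/t² = b and I√3·(a − 2t² + 2)/t = −u. (In other words, the composition ξ₁ ∘ ξ₂ of the paper's parameter correspondences acts on the parameters by (a₂₀, t₁) ↦ (a₂₀, −t₁).) -/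
/-- The composition `ξ₁ ∘ ξ₂` of the parameter correspondences of
Proposition 21 (between the moduli slices of `[[6A₂],[A₅]]` and `[[4A₂,A₅],[2A₂]]`)
acts on the slice parameters by `(a₂₀, t₁) ↦ (a₂₀, −t₁)`. -/
theorem xi1_comp_xi2 (b u : ℂ) (hu : u ≠ 0) (h : -1 + u ^ 2 + b ≠ 0)
    (a t : ℂ)
    (ha : a = -(1 / 2) * (3 * b ^ 2 + 5 * b * u ^ 2 - 6 * b - u ^ 2 + 3 + 2 * u ^ 4) / u ^ 2)
    (htt : t = -(1 / 2) * Complex.I * (Real.sqrt 3 : ℂ) * (-1 + u ^ 2 + b) / u) :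
    t ≠ 0 ∧
    (3 * a ^ 2 - 10 * a * t ^ 2 + 12 * a - 19 * t ^ 2 + 8 * t ^ 4 + 12) / t ^ 2 = b ∧
    Complex.I * (Real.sqrt 3 : ℂ) * (a - 2 * t ^ 2 + 2) / t = -u := by
  have hs : (Complex.I * (Real.sqrt 3 : ℂ)) ^ 2 = -3 := by
    rw [mul_pow, Complex.I_sq, ← Complex.ofReal_pow, Real.sq_sqrt (by norm_num)]
    norm_num
  have hs0 : Complex.I * (Real.sqrt 3 : ℂ) ≠ 0 := by
    intro h0
    norm_num [h0] at hs
  have htu : t * u = -(1 / 2) * (Complex.I * (Real.sqrt 3 : ℂ)) * (-1 + u ^ 2 + b) := by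
    rw [htt]
    field_simp
  have ht : t ≠ 0 := by
    rintro rfl
    have : -(1 / 2) * (Complex.I * (Real.sqrt 3 : ℂ)) * (-1 + u ^ 2 + b) ≠ 0 :=
      mul_ne_zero (mul_ne_zero (by norm_num) hs0) h
    exact this (by rw [← htu, zero_mul])
  have htsq : t ^ 2 * u ^ 2 = -(3 / 4) * (-1 + u ^ 2 + b) ^ 2 := by
    rw [← mul_pow, htu]
    linear_combination (1 / 4) * (-1 + u ^ 2 + b) ^ 2 * hs
  have hau : a * u ^ 2 =
      -(1 / 2) * (3 * b ^ 2 + 5 * b * u ^ 2 - 6 * b - u ^ 2 + 3 + 2 * u ^ 4) := by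
    rw [ha]
    field_simp
  have hat : a = 2 * t ^ 2 + (-1 + u ^ 2 + b) / 2 - 2 := by
    refine mul_right_cancel₀ (pow_ne_zero 2 hu) ?_
    linear_combination hau - 2 * htsq
  refine ⟨ht, ?_, ?_⟩
  · rw [div_eq_iff (pow_ne_zero 2 ht), hat]
    linear_combination htsq
  · rw [div_eq_iff ht, hat]
    linear_combination htu
end
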